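/- Let p be a prime and f₁,…,f_r ∈ ℚ_p[x₁,…,xₙ], not all zero. Set g := ∑_{i=1}^r fᵢ(x)·yᵢ ∈ ℚ_p[x₁,…,xₙ,y₁,…,y_r]. Then for every s ∈ ℂ with Re(s) > 0, Z(g;s) = ((1 - p^{-1})/(1 - p^{-s-1})) · Z(𝐟;s), where Z(g;s) is the p-adic Igusa zeta function of g (an integral over ℤ_p^{n+r}) and Z(𝐟;s) is the p-adic Igusa zeta function of the mapping 𝐟 = (f₁,…,f_r). -/

import Mathlib

open MeasureTheory MvPolynomial

open scoped Classical in
/-- `|q|_p^s := p^{-s · ord_p q}`, interpreted as `0` when `q = 0`. -/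
noncomputable def padicPow (p : ℕ) [Fact p.Prime] (s : ℂ) (q : ℚ_[p]) : ℂ :=
  if q = 0 then 0 else (p : ℂ) ^ (-s * (q.valuation : ℂ))

open scoped Classical in
/-- The integrand `‖𝐟(x)‖_p^s = (max_i |f_i(x)|_p)^s`, interpreted as `0` when all
`f_i(x)` vanish. -/
noncomputable def padicMapIntegrand (p : ℕ) [Fact p.Prime] {n r : ℕ}
    (f : Fin r → MvPolynomial (Fin n) ℚ_[p]) (s : ℂ) (x : Fin n → ℚ_[p]) : ℂ :=
  if ∀ i, eval x (f i) = 0 then 0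
  else ((⨆ i, ‖eval x (f i)‖ : ℝ) : ℂ) ^ s


namespace Igusa

/-- Two Haar measures giving the same mass to a compact set with nonempty interior agree. -/
lemma haar_eq {G : Type*} [AddCommGroup G] [TopologicalSpace G] [IsTopologicalAddGroup G]
    [MeasurableSpace G] [BorelSpace G] [SecondCountableTopology G] [LocallyCompactSpace G]
    (μ ν : Measure G) [μ.IsAddHaarMeasure] [ν.IsAddHaarMeasure] (K : Set G)
    (hK : IsCompact K) (hK' : (interior K).Nonempty) (h : μ K = ν K) : μ = ν := by
  let K₀ : TopologicalSpace.PositiveCompacts G := ⟨⟨K, hK⟩, hK'⟩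
  have h1 := Measure.addHaarMeasure_unique μ K₀
  have h2 := Measure.addHaarMeasure_unique ν K₀
  have h3 : μ K₀ = ν K₀ := h
  rw [h1, h2, h3]

variable (p : ℕ) [hp : Fact p.Prime]

lemma padicPow_eq (s : ℂ) (hs : s ≠ 0) (q : ℚ_[p]) : padicPow p s q = (‖q‖ : ℂ) ^ s := by
  unfold padicPow
  split_ifs with h
  · simp [h, Complex.zero_cpow hs]
  · have hp0 : (0 : ℝ) < p := by exact_mod_cast hp.out.pos
    have e : ‖q‖ = (p : ℝ) ^ (((-q.valuation : ℤ)) : ℝ) := by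
      rw [Padic.norm_eq_zpow_neg_valuation h, Real.rpow_intCast]
    rw [e, Complex.ofReal_cpow hp0.le]
    have h2 : Complex.log ((p : ℝ) : ℂ) = ((Real.log p : ℝ) : ℂ) := (Complex.ofReal_log hp0.le).symm
    have hpc : (((p : ℝ)) : ℂ) ≠ 0 := by exact_mod_cast hp0.ne'
    have h3 : (p : ℂ) = ((p : ℝ) : ℂ) := by simp
    rw [h3, ← Complex.cpow_mul]
    · push_cast; ring_nf
    · rw [h2, ← Complex.ofReal_mul, Complex.ofReal_im]; linarith [Real.pi_pos]
    · rw [h2, ← Complex.ofReal_mul, Complex.ofReal_im]; exact Real.pi_pos.le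

lemma mapIntegrand_eq {n r : ℕ} (f : Fin r → MvPolynomial (Fin n) ℚ_[p]) (s : ℂ) (hs : s ≠ 0)
    (x : Fin n → ℚ_[p]) :
    padicMapIntegrand p f s x = ((⨆ i, ‖eval x (f i)‖ : ℝ) : ℂ) ^ s := by
  unfold padicMapIntegrand
  split_ifs with h
  · simp [h, Complex.zero_cpow hs]
  · rfl

lemma ball_eq {ι : Type*} [Fintype ι] :
    {x : ι → ℚ_[p] | ∀ i, ‖x i‖ ≤ 1} = Metric.closedBall 0 1 := by
  ext x
  simp [pi_norm_le_iff_of_nonneg]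

lemma ball_compact {ι : Type*} [Fintype ι] : IsCompact {x : ι → ℚ_[p] | ∀ i, ‖x i‖ ≤ 1} := by
  rw [ball_eq]; exact isCompact_closedBall _ _

lemma ball_int {ι : Type*} [Fintype ι] :
    (interior {x : ι → ℚ_[p] | ∀ i, ‖x i‖ ≤ 1}).Nonempty := by
  rw [ball_eq]
  exact ⟨0, Metric.ball_subset_interior_closedBall (Metric.mem_ball_self one_pos)⟩

variable [MeasurableSpace ℚ_[p]] [BorelSpace ℚ_[p]]

/-- Normalised Haar measure on `ℚ_p`. -/
noncomputable def vol : Measure ℚ_[p] :=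
  Measure.addHaarMeasure ⟨⟨Metric.closedBall 0 1, isCompact_closedBall _ _⟩,
    ⟨0, Metric.ball_subset_interior_closedBall (Metric.mem_ball_self one_pos)⟩⟩

instance : (vol p).IsAddHaarMeasure := by unfold vol; infer_instance

lemma vol_ball : vol p (Metric.closedBall 0 1) = 1 :=
  Measure.addHaarMeasure_self

lemma vol_small : (p : ENNReal) * vol p (Metric.ball 0 1) = 1 := by
  rw [← vol_ball p]
  have hU : Metric.closedBall (0 : ℚ_[p]) 1 =
      ⋃ j : Fin p, (fun x => (-((j : ℕ) : ℚ_[p])) + x) ⁻¹' Metric.ball 0 1 := by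
    ext x
    simp only [Metric.mem_closedBall, dist_zero_right, Set.mem_iUnion, Set.mem_preimage,
      Metric.mem_ball]
    constructor
    · intro hx
      refine ⟨⟨PadicInt.zmodRepr (p := p) ⟨x, hx⟩, PadicInt.zmodRepr_lt_p _⟩, ?_⟩
      have := PadicInt.norm_sub_zmodRepr_lt_one (⟨x, hx⟩ : ℤ_[p])
      rw [PadicInt.norm_def] at this
      rwa [neg_add_eq_sub]
    · rintro ⟨j, hj⟩
      have h1 : ‖((j : ℕ) : ℚ_[p])‖ ≤ 1 := by
        simpa using Padic.norm_int_le_one (p := p) (j : ℕ)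
      calc ‖x‖ = ‖((j : ℕ) : ℚ_[p]) + (-((j : ℕ) : ℚ_[p]) + x)‖ := by congr 1; ring
        _ ≤ max _ _ := Padic.nonarchimedean _ _
        _ ≤ 1 := max_le h1 hj.le
  rw [hU, measure_iUnion]
  · simp only [measure_preimage_add, tsum_fintype, Finset.sum_const, Finset.card_univ,
      Fintype.card_fin, nsmul_eq_mul]
  · intro i j hij
    rw [Function.onFun, Set.disjoint_left]
    intro x hx hy
    simp only [Set.mem_preimage, Metric.mem_ball, dist_zero_right] at hx hy
    apply hij
    have h1 : ‖(((i : ℕ) - (j : ℕ) : ℤ) : ℚ_[p])‖ < 1 := by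
      calc ‖(((i : ℕ) - (j : ℕ) : ℤ) : ℚ_[p])‖
          = ‖(-((j : ℕ) : ℚ_[p]) + x) + -(-((i : ℕ) : ℚ_[p]) + x)‖ := by
            congr 1; push_cast; ring
        _ ≤ max _ _ := Padic.nonarchimedean _ _
        _ < 1 := max_lt hy (by rwa [norm_neg])
    rw [Padic.norm_intCast_lt_one_iff] at h1
    have hi := i.2
    have hj := j.2
    have h2 : ((i : ℕ) - (j : ℕ) : ℤ) = 0 := by
      apply Int.eq_zero_of_abs_lt_dvd h1
      rw [abs_lt]; omega
    ext; omega
  · intro j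
    exact (measurable_const_add _) Metric.isOpen_ball.measurableSet

/-- Multiplication by `p` on `ℚ_p`. -/
noncomputable def scale : ℚ_[p] ≃L[ℚ_[p]] ℚ_[p] :=
  (LinearEquiv.smulOfNeZero ℚ_[p] ℚ_[p] (p : ℚ_[p])
    (by exact_mod_cast hp.out.ne_zero)).toContinuousLinearEquiv

lemma scale_apply (x : ℚ_[p]) : scale p x = p * x := rfl

lemma scale_preimage : scale p ⁻¹' (Metric.ball 0 1) = Metric.closedBall 0 1 := by
  ext x
  have hp0 : (0 : ℝ) < p := by exact_mod_cast hp.out.pos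
  have := Padic.norm_le_pow_iff_norm_lt_pow_add_one x 0
  simp only [zpow_zero, zero_add, zpow_one] at this
  simp only [Set.mem_preimage, Metric.mem_ball, dist_zero_right, Metric.mem_closedBall,
    scale_apply, norm_mul, Padic.norm_p, this]
  rw [inv_mul_lt_iff₀ hp0, mul_one]

lemma ball_isCompact : IsCompact (Metric.ball (0 : ℚ_[p]) 1) := by
  have : (scale p) '' (Metric.closedBall 0 1) = Metric.ball 0 1 := by
    rw [← scale_preimage, Set.image_preimage_eq _ (scale p).surjective]
  rw [← this]
  exact (isCompact_closedBall _ _).image (scale p).continuous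

lemma map_scale : (vol p).map (scale p) = (p : ENNReal) • vol p := by
  have hp0 : (p : ENNReal) ≠ 0 := by exact_mod_cast hp.out.ne_zero
  have : ((p : ENNReal) • vol p).IsAddHaarMeasure :=
    Measure.IsAddHaarMeasure.smul _ hp0 (ENNReal.natCast_ne_top p)
  have := (scale p).isAddHaarMeasure_map (vol p)
  apply haar_eq _ _ (Metric.ball 0 1) (ball_isCompact p)
  · rw [Metric.isOpen_ball.interior_eq]
    exact ⟨0, Metric.mem_ball_self one_pos⟩
  · rw [Measure.map_apply (scale p).continuous.measurable Metric.isOpen_ball.measurableSet,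
      scale_preimage, vol_ball, Measure.smul_apply, smul_eq_mul, vol_small]

lemma integrand_cont (s : ℂ) (hs : 0 < s.re) :
    Continuous (fun x : ℚ_[p] => (‖x‖ : ℂ) ^ s) :=
  (Complex.continuous_ofReal_cpow_const hs).comp continuous_norm

lemma integral_one_dim (s : ℂ) (hs : 0 < s.re) :
    ∫ x in Metric.closedBall (0 : ℚ_[p]) 1, (‖x‖ : ℂ) ^ s ∂(vol p)
      = (1 - (p : ℂ)⁻¹) / (1 - (p : ℂ) ^ (-s - 1)) := by
  set I := ∫ x in Metric.closedBall (0 : ℚ_[p]) 1, (‖x‖ : ℂ) ^ s ∂(vol p) with hI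
  have hp0 : (0 : ℝ) < p := by exact_mod_cast hp.out.pos
  have hpc : (p : ℂ) ≠ 0 := by exact_mod_cast hp.out.ne_zero
  have hintg : IntegrableOn (fun x : ℚ_[p] => (‖x‖ : ℂ) ^ s) (Metric.closedBall 0 1) (vol p) :=
    (integrand_cont p s hs).continuousOn.integrableOn_compact (isCompact_closedBall _ _)
  have hsub : Metric.ball (0 : ℚ_[p]) 1 ⊆ Metric.closedBall 0 1 := Metric.ball_subset_closedBall
  have hmeas : MeasurableSet (Metric.ball (0 : ℚ_[p]) 1) := Metric.isOpen_ball.measurableSet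
  have hreal : (vol p).real (Metric.ball 0 1) = (p : ℝ)⁻¹ := by
    have := congrArg ENNReal.toReal (vol_small p)
    rw [ENNReal.toReal_mul] at this
    simp only [ENNReal.toReal_natCast, ENNReal.toReal_one] at this
    rw [Measure.real]
    field_simp
    linarith
  have hsplit : I = (∫ x in Metric.ball (0 : ℚ_[p]) 1, (‖x‖ : ℂ) ^ s ∂(vol p))
      + ∫ x in Metric.closedBall (0 : ℚ_[p]) 1 \ Metric.ball 0 1, (‖x‖ : ℂ) ^ s ∂(vol p) := by
    rw [hI, ← setIntegral_union Set.disjoint_sdiff_right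
      (Metric.isClosed_closedBall.measurableSet.diff hmeas) (hintg.mono_set hsub)
      (hintg.mono_set Set.sdiff_subset), Set.union_sdiff_cancel hsub]
  have hA : ∫ x in Metric.closedBall (0 : ℚ_[p]) 1 \ Metric.ball 0 1, (‖x‖ : ℂ) ^ s ∂(vol p)
      = 1 - (p : ℂ)⁻¹ := by
    rw [setIntegral_congr_fun (g := fun _ => (1 : ℂ))
      (Metric.isClosed_closedBall.measurableSet.diff hmeas)]
    · rw [setIntegral_const, measureReal_sdiff hsub hmeas
        (by exact (measure_closedBall_lt_top).ne), hreal, Measure.real, vol_ball]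
      simp
    · intro x hx
      simp only [Set.mem_sdiff, Metric.mem_closedBall, dist_zero_right, Metric.mem_ball,
        not_lt] at hx
      have : ‖x‖ = 1 := le_antisymm hx.1 hx.2
      simp [this]
  have hB : (p : ℂ) * (∫ x in Metric.ball (0 : ℚ_[p]) 1, (‖x‖ : ℂ) ^ s ∂(vol p))
      = (p : ℂ) ^ (-s) * I := by
    have h1 := (scale p).toHomeomorph.measurableEmbedding.setIntegral_map (μ := vol p)
      (fun x : ℚ_[p] => (‖x‖ : ℂ) ^ s) (Metric.ball 0 1)
    have h2 : ((scale p).toHomeomorph : ℚ_[p] → ℚ_[p]) = scale p := rfl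
    rw [h2, map_scale, scale_preimage, Measure.restrict_smul, integral_smul_measure] at h1
    simp only [ENNReal.toReal_natCast] at h1
    rw [Complex.real_smul, Complex.ofReal_natCast] at h1
    rw [h1, hI, ← integral_const_mul]
    congr 1
    ext x
    rw [scale_apply, norm_mul, Padic.norm_p, Complex.ofReal_mul,
      Complex.mul_cpow_ofReal_nonneg (by positivity) (norm_nonneg _), Complex.cpow_neg,
      Complex.ofReal_inv, Complex.inv_cpow]
    · rw [Complex.ofReal_natCast]
    rw [Complex.ofReal_natCast, Complex.natCast_arg]
    exact Real.pi_pos.ne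
  have hpow : (p : ℂ) ^ (-s - 1) = (p : ℂ) ^ (-s) / p := by
    rw [Complex.cpow_sub _ _ hpc, Complex.cpow_one]
  have hne : 1 - (p : ℂ) ^ (-s - 1) ≠ 0 := by
    intro h
    have h1 : ‖(p : ℂ) ^ (-s - 1)‖ = 1 := by
      rw [← sub_eq_zero.1 h]; simp
    rw [Complex.norm_natCast_cpow_of_pos hp.out.pos] at h1
    have : (p : ℝ) ^ (-s - 1).re < 1 := by
      apply Real.rpow_lt_one_of_one_lt_of_neg
      · exact_mod_cast hp.out.one_lt
      · simp; linarith
    linarith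
  rw [eq_div_iff hne, hpow]
  rw [hA] at hsplit
  have hinv : (p : ℂ) * (p : ℂ)⁻¹ = 1 := mul_inv_cancel₀ hpc
  field_simp
  linear_combination (p : ℂ) * hsplit + hB - hinv

/-- The shear `y ↦ y + φ(y) e_i`. -/
noncomputable def shear {r : ℕ} (b : Fin r → ℚ_[p]) (i : Fin r) (hb : b i = 1) :
    (Fin r → ℚ_[p]) ≃L[ℚ_[p]] (Fin r → ℚ_[p]) :=
  LinearEquiv.toContinuousLinearEquiv
  { toFun := fun y => Function.update y i (∑ j, b j * y j)
    invFun := fun y => Function.update y i (2 * y i - ∑ j, b j * y j)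
    map_add' := by
      intro x y
      ext k
      by_cases h : k = i
      · subst h; simp [mul_add, Finset.sum_add_distrib]
      · simp [h]
    map_smul' := by
      intro c y
      ext k
      by_cases h : k = i
      · subst h; simp [Finset.mul_sum, mul_left_comm]
      · simp [h]
    left_inv := by
      intro y
      ext k
      by_cases h : k = i
      · subst h
        have e1 := Finset.add_sum_erase Finset.univ (fun j => b j * y j) (Finset.mem_univ k)
        have e2 := Finset.add_sum_erase Finset.univ
          (fun j => b j * Function.update y k (∑ j, b j * y j) j) (Finset.mem_univ k)
        have e3 : ∑ j ∈ Finset.univ.erase k, b j * Function.update y k (∑ j, b j * y j) j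
            = ∑ j ∈ Finset.univ.erase k, b j * y j := by
          apply Finset.sum_congr rfl
          intro j hj
          rw [Function.update_of_ne (Finset.ne_of_mem_erase hj)]
        simp only [Function.update_self, hb, one_mul] at e1 e2 ⊢
        rw [← e2, e3]
        linear_combination -e1
      · simp [h]
    right_inv := by
      intro y
      ext k
      by_cases h : k = i
      · subst h
        have e1 := Finset.add_sum_erase Finset.univ (fun j => b j * y j) (Finset.mem_univ k)
        have e2 := Finset.add_sum_erase Finset.univ
          (fun j => b j * Function.update y k (2 * y k - ∑ j, b j * y j) j) (Finset.mem_univ k)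
        have e3 : ∑ j ∈ Finset.univ.erase k,
              b j * Function.update y k (2 * y k - ∑ j, b j * y j) j
            = ∑ j ∈ Finset.univ.erase k, b j * y j := by
          apply Finset.sum_congr rfl
          intro j hj
          rw [Function.update_of_ne (Finset.ne_of_mem_erase hj)]
        simp only [Function.update_self, hb, one_mul] at e1 e2 ⊢
        rw [← e2, e3]
        linear_combination e1
      · simp [h] }

lemma shear_apply {r : ℕ} (b : Fin r → ℚ_[p]) (i : Fin r) (hb : b i = 1) (y : Fin r → ℚ_[p]) :
    shear p b i hb y = Function.update y i (∑ j, b j * y j) := rfl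

lemma shear_preimage {r : ℕ} (b : Fin r → ℚ_[p]) (i : Fin r) (hb : b i = 1)
    (hb' : ∀ j, ‖b j‖ ≤ 1) :
    shear p b i hb ⁻¹' {y | ∀ j, ‖y j‖ ≤ 1} = {y | ∀ j, ‖y j‖ ≤ 1} := by
  have key : ∀ y : Fin r → ℚ_[p], (∀ j, j ≠ i → ‖y j‖ ≤ 1) →
      ‖∑ j ∈ Finset.univ.erase i, b j * y j‖ ≤ 1 := by
    intro y hy
    apply IsUltrametricDist.norm_sum_le_of_forall_le_of_nonneg zero_le_one
    intro j hj
    rw [norm_mul]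
    exact mul_le_one₀ (hb' j) (norm_nonneg _) (hy j (Finset.ne_of_mem_erase hj))
  ext y
  have e1 := Finset.add_sum_erase Finset.univ (fun j => b j * y j) (Finset.mem_univ i)
  simp only [hb, one_mul] at e1
  simp only [Set.mem_preimage, Set.mem_ofPred_eq, shear_apply]
  constructor
  · intro h
    have h' : ∀ j, j ≠ i → ‖y j‖ ≤ 1 := by
      intro j hj
      have := h j
      rwa [Function.update_of_ne hj] at this
    intro j
    by_cases hj : j = i
    · subst hj
      have h2 := h j
      rw [Function.update_self] at h2
      have e : y j = (∑ j, b j * y j) + -∑ k ∈ Finset.univ.erase j, b k * y k := by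
        linear_combination e1
      rw [e]
      exact (Padic.nonarchimedean _ _).trans
        (max_le h2 (by rw [norm_neg]; exact key y h'))
    · exact h' j hj
  · intro h j
    by_cases hj : j = i
    · subst hj
      rw [Function.update_self, ← e1]
      exact (Padic.nonarchimedean _ _).trans (max_le (h j) (key y fun j _ => h j))
    · rw [Function.update_of_ne hj]; exact h j

lemma pi_ball {r : ℕ} :
    Measure.pi (fun _ : Fin r => vol p) {y : Fin r → ℚ_[p] | ∀ j, ‖y j‖ ≤ 1} = 1 := by
  have : {y : Fin r → ℚ_[p] | ∀ j, ‖y j‖ ≤ 1}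
      = Set.univ.pi (fun _ => Metric.closedBall (0 : ℚ_[p]) 1) := by
    ext; simp
  rw [this, Measure.pi_pi]
  simp [vol_ball]

lemma map_shear {r : ℕ} (b : Fin r → ℚ_[p]) (i : Fin r) (hb : b i = 1)
    (hb' : ∀ j, ‖b j‖ ≤ 1) :
    (Measure.pi (fun _ : Fin r => vol p)).map (shear p b i hb)
      = Measure.pi (fun _ : Fin r => vol p) := by
  have := (shear p b i hb).isAddHaarMeasure_map (Measure.pi (fun _ : Fin r => vol p))
  apply haar_eq _ _ _ (ball_compact p) (ball_int p)
  rw [Measure.map_apply (shear p b i hb).continuous.measurable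
    (ball_compact p).isClosed.measurableSet, shear_preimage p b i hb hb']

lemma integral_coord {r : ℕ} (s : ℂ) (hs : 0 < s.re) (i : Fin r) :
    ∫ y in {y : Fin r → ℚ_[p] | ∀ j, ‖y j‖ ≤ 1}, (‖y i‖ : ℂ) ^ s
        ∂(Measure.pi (fun _ : Fin r => vol p))
      = (1 - (p : ℂ)⁻¹) / (1 - (p : ℂ) ^ (-s - 1)) := by
  have : {y : Fin r → ℚ_[p] | ∀ j, ‖y j‖ ≤ 1}
      = Set.univ.pi (fun _ => Metric.closedBall (0 : ℚ_[p]) 1) := by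
    ext; simp
  rw [this, Measure.restrict_pi_pi]
  have : IsProbabilityMeasure ((vol p).restrict (Metric.closedBall (0 : ℚ_[p]) 1)) :=
    ⟨by simp [vol_ball]⟩
  rw [integral_comp_eval (μ := fun _ : Fin r => (vol p).restrict (Metric.closedBall 0 1))
    (f := fun x : ℚ_[p] => (‖x‖ : ℂ) ^ s) (integrand_cont p s hs).aestronglyMeasurable]
  exact integral_one_dim p s hs

lemma integral_linear {r : ℕ} (s : ℂ) (hs : 0 < s.re) (a : Fin r → ℚ_[p]) :
    ∫ y in {y : Fin r → ℚ_[p] | ∀ j, ‖y j‖ ≤ 1}, (‖∑ j, a j * y j‖ : ℂ) ^ s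
        ∂(Measure.pi (fun _ : Fin r => vol p))
      = (1 - (p : ℂ)⁻¹) / (1 - (p : ℂ) ^ (-s - 1)) * ((⨆ i, ‖a i‖ : ℝ) : ℂ) ^ s := by
  have hs0 : s ≠ 0 := by rintro rfl; simp at hs
  by_cases ha : ∀ i, a i = 0
  · simp [ha, Complex.zero_cpow hs0]
  · push Not at ha
    obtain ⟨i₀, hi₀⟩ := ha
    have : Nonempty (Fin r) := ⟨i₀⟩
    obtain ⟨i, hi⟩ := Finite.exists_max (fun i => ‖a i‖)
    have hai : a i ≠ 0 := by
      intro h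
      have := hi i₀
      rw [h, norm_zero, norm_le_zero_iff] at this
      exact hi₀ this
    have hsup : (⨆ i, ‖a i‖) = ‖a i‖ :=
      le_antisymm (ciSup_le hi) (le_ciSup (f := fun i => ‖a i‖) (Set.finite_range _).bddAbove i)
    let b : Fin r → ℚ_[p] := fun j => a j / a i
    have hb : b i = 1 := div_self hai
    have hb' : ∀ j, ‖b j‖ ≤ 1 := by
      intro j
      rw [norm_div]
      exact div_le_one_of_le₀ (hi j) (norm_nonneg _)
    have h1 := (shear p b i hb).toHomeomorph.measurableEmbedding.setIntegral_map
      (μ := Measure.pi (fun _ : Fin r => vol p))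
      (fun y : Fin r → ℚ_[p] => (‖y i‖ : ℂ) ^ s) {y | ∀ j, ‖y j‖ ≤ 1}
    have h2 : ((shear p b i hb).toHomeomorph : (Fin r → ℚ_[p]) → _) = shear p b i hb := rfl
    rw [h2, map_shear p b i hb hb', shear_preimage p b i hb hb', integral_coord p s hs] at h1
    rw [hsup, h1, mul_comm, ← integral_const_mul]
    congr 1
    ext y
    rw [shear_apply, Function.update_self, ← Complex.mul_cpow_ofReal_nonneg (norm_nonneg _)
      (norm_nonneg _), ← Complex.ofReal_mul, ← norm_mul, Finset.mul_sum]
    congr 4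
    ext j
    simp only [b]
    field_simp

end Igusa

theorem stmt13 (p : ℕ) [Fact p.Prime] {n r : ℕ}
    [MeasurableSpace ℚ_[p]] [BorelSpace ℚ_[p]]
    (μ : Measure (Fin n → ℚ_[p])) [μ.IsAddHaarMeasure]
    (hμ : μ {x : Fin n → ℚ_[p] | ∀ i, ‖x i‖ ≤ 1} = 1)
    (η : Measure ((Fin n ⊕ Fin r) → ℚ_[p])) [η.IsAddHaarMeasure]
    (hη : η {x : (Fin n ⊕ Fin r) → ℚ_[p] | ∀ i, ‖x i‖ ≤ 1} = 1)
    (f : Fin r → MvPolynomial (Fin n) ℚ_[p]) (hf : ∃ i, f i ≠ 0)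
    (s : ℂ) (hs : 0 < s.re) :
    (∫ x in {x : (Fin n ⊕ Fin r) → ℚ_[p] | ∀ i, ‖x i‖ ≤ 1},
        padicPow p s
          (eval x (∑ i : Fin r, rename Sum.inl (f i) * X (Sum.inr i))) ∂η)
      = ((1 - (p : ℂ)⁻¹) / (1 - (p : ℂ) ^ (-s - 1))) *
          ∫ x in {x : Fin n → ℚ_[p] | ∀ i, ‖x i‖ ≤ 1}, padicMapIntegrand p f s x ∂μ := by
  have hs0 : s ≠ 0 := by rintro rfl; simp at hs
  simp only [Igusa.padicPow_eq p s hs0, Igusa.mapIntegrand_eq p f s hs0]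
  let ν : Measure (Fin r → ℚ_[p]) := Measure.pi (fun _ : Fin r => Igusa.vol p)
  let e := ContinuousLinearEquiv.sumPiEquivProdPi ℚ_[p] (Fin n) (Fin r) (fun _ => ℚ_[p])
  have hpre : e ⁻¹' ({x : Fin n → ℚ_[p] | ∀ i, ‖x i‖ ≤ 1} ×ˢ
      {x : Fin r → ℚ_[p] | ∀ i, ‖x i‖ ≤ 1})
      = {x : (Fin n ⊕ Fin r) → ℚ_[p] | ∀ i, ‖x i‖ ≤ 1} := by
    ext x
    simp only [Set.mem_preimage, Set.mem_prod, Set.mem_ofPred_eq, Sum.forall]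
    rfl
  have hc : IsCompact ({x : Fin n → ℚ_[p] | ∀ i, ‖x i‖ ≤ 1} ×ˢ
      {x : Fin r → ℚ_[p] | ∀ i, ‖x i‖ ≤ 1}) :=
    (Igusa.ball_compact p).prod (Igusa.ball_compact p)
  have hmap : η.map e = μ.prod ν := by
    have : ν.IsAddHaarMeasure := by simp only [ν]; infer_instance
    have : (μ.prod ν).IsAddHaarMeasure := Measure.prod.instIsAddHaarMeasure μ ν
    have := e.isAddHaarMeasure_map η
    apply Igusa.haar_eq _ _ _ hc
    · rw [interior_prod_eq]
      exact (Igusa.ball_int p).prod (Igusa.ball_int p)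
    · rw [Measure.map_apply e.continuous.measurable hc.isClosed.measurableSet, hpre, hη,
        Measure.prod_prod, hμ, Igusa.pi_ball, one_mul]
  have h1 := e.toHomeomorph.measurableEmbedding.setIntegral_map (μ := η)
      (fun z : (Fin n → ℚ_[p]) × (Fin r → ℚ_[p]) =>
        (‖∑ j, eval z.1 (f j) * z.2 j‖ : ℂ) ^ s)
      ({x : Fin n → ℚ_[p] | ∀ i, ‖x i‖ ≤ 1} ×ˢ {x : Fin r → ℚ_[p] | ∀ i, ‖x i‖ ≤ 1})
  have h2 : (e.toHomeomorph : (Fin n ⊕ Fin r → ℚ_[p]) → _) = e := rfl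
  rw [h2, hpre, hmap, setIntegral_prod] at h1
  · simp only [ν, Igusa.integral_linear p s hs] at h1
    rw [← integral_const_mul, h1]
    congr 1
    ext x
    simp only [map_sum, map_mul, eval_rename, eval_X]
    rfl
  · refine ContinuousOn.integrableOn_compact hc ?_
    apply Continuous.continuousOn
    apply (Igusa.integrand_cont p s hs).comp
    refine continuous_finsetSum _ fun j _ => ?_
    exact ((MvPolynomial.continuous_eval (f j)).comp continuous_fst).mul
      ((continuous_apply j).comp continuous_snd)
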